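/- arXiv:1211.1914 — 5 statements merged into one kernel-verified Lean document; each statement's English description precedes it below -/
import Mathlib

section
/- Let V be a finite-dimensional real normed vector space and C ⊆ V a nonempty convex cone. Then the strict convex dual C⊛ is nonempty if and only if the closure of C is salient, i.e., closure(C) ∩ (−closure(C)) ⊆ {0} (equivalently, closure(C) contains no line through the origin). -/
open Pointwise

/-- The strict convex dual of a set of vectors: functionals strictly positive on the
nonzero elements of the closure of the set. -/
def strictConeDual {V : Type*} [NormedAddCommGroup V] [NormedSpace ℝ V] (C : Set V) :
    Set (V →L[ℝ] ℝ) :=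
  {u | ∀ v ∈ closure C, v ≠ 0 → 0 < u v}

/-- A point whose negative lies outside a closed convex cone is strictly positive for some functional
which is nonnegative on the cone. -/
theorem exists_nonneg_and_pos_of_neg_notMem {V : Type*} [NormedAddCommGroup V] [NormedSpace ℝ V]
    {D : Set V} (hclosed : IsClosed D) (hadd : ∀ v ∈ D, ∀ w ∈ D, v + w ∈ D)
    (hsmul : ∀ t : ℝ, 0 < t → ∀ v ∈ D, t • v ∈ D) {v : V} (hv : v ∈ D) (hneg : -v ∉ D) :
    ∃ u : V →L[ℝ] ℝ, (∀ w ∈ D, 0 ≤ u w) ∧ 0 < u v := by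
  have hconvex : Convex ℝ D := by
    rw [convex_iff_forall_pos]
    exact fun x hx y hy a b ha hb _ ↦ hadd _ (hsmul a ha x hx) _ (hsmul b hb y hy)
  obtain ⟨u, c, hc, hu⟩ := geometric_hahn_banach_point_closed hconvex hclosed hneg
  have hnonneg : ∀ w ∈ D, 0 ≤ u w := by
    intro w hw
    by_contra! hlt
    have hc0 : c < 0 := (hu w hw).trans hlt
    have h := hu _ (hsmul (c / u w) (div_pos_of_neg_of_neg hc0 hlt) w hw)
    rw [map_smul, smul_eq_mul, div_mul_cancel₀ c hlt.ne] at h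
    exact h.false
  refine ⟨u, hnonneg, (hnonneg v hv).lt_of_ne fun h ↦ ?_⟩
  rw [map_neg] at hc
  linarith [hu v hv]

/-- A closed salient convex cone admits a functional which is positive off the origin. -/
theorem exists_pos_of_salient {V : Type*} [NormedAddCommGroup V] [NormedSpace ℝ V]
    [FiniteDimensional ℝ V] {D : Set V} (hclosed : IsClosed D)
    (hadd : ∀ v ∈ D, ∀ w ∈ D, v + w ∈ D) (hsmul : ∀ t : ℝ, 0 < t → ∀ v ∈ D, t • v ∈ D)
    (hsal : D ∩ (-D) ⊆ {0}) : ∃ u : V →L[ℝ] ℝ, ∀ v ∈ D, v ≠ 0 → 0 < u v := by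
  have : ProperSpace V := FiniteDimensional.proper ℝ V
  have hcompact : IsCompact (D ∩ Metric.sphere 0 1) :=
    (isCompact_sphere (0 : V) 1).inter_left hclosed
  obtain ⟨u, -, hu⟩ : ∃ u : V →L[ℝ] ℝ,
      (∀ w ∈ D, 0 ≤ u w) ∧ ∀ v ∈ D ∩ Metric.sphere 0 1, v ∈ D → 0 < u v := by
    refine hcompact.induction_on
      (p := fun s ↦ ∃ u : V →L[ℝ] ℝ, (∀ w ∈ D, 0 ≤ u w) ∧ ∀ v ∈ s, v ∈ D → 0 < u v)
      ⟨0, by simp, by simp⟩ ?_ ?_ ?_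
    · rintro s t hst ⟨u, hu, hut⟩
      exact ⟨u, hu, fun v hv ↦ hut v (hst hv)⟩
    · rintro s t ⟨u, hu, hus⟩ ⟨u', hu', hut⟩
      refine ⟨u + u', fun w hw ↦ add_nonneg (hu w hw) (hu' w hw), ?_⟩
      rintro v (hv | hv) hvD
      · exact add_pos_of_pos_of_nonneg (hus v hv hvD) (hu' v hvD)
      · exact add_pos_of_nonneg_of_pos (hu v hvD) (hut v hv hvD)
    · rintro x ⟨hx, hx1⟩
      have hx0 : x ≠ 0 := ne_zero_of_mem_unit_sphere ⟨x, hx1⟩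
      obtain ⟨u, hu, hux⟩ := exists_nonneg_and_pos_of_neg_notMem hclosed hadd hsmul hx
        fun h ↦ hx0 (hsal ⟨hx, h⟩)
      exact ⟨{v | 0 < u v},
        mem_nhdsWithin_of_mem_nhds ((isOpen_lt continuous_const u.continuous).mem_nhds hux),
        u, hu, fun v hv _ ↦ hv⟩
  refine ⟨u, fun v hv hv0 ↦ ?_⟩
  have hnorm : 0 < ‖v‖⁻¹ := inv_pos.mpr (norm_pos_iff.mpr hv0)
  have hmem : ‖v‖⁻¹ • v ∈ D := hsmul _ hnorm v hv
  have hpos := hu _ ⟨hmem, by simp [norm_smul, norm_ne_zero_iff.mpr hv0]⟩ hmem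
  rw [map_smul, smul_eq_mul] at hpos
  exact pos_of_mul_pos_right hpos hnorm.le

/-- For a nonempty convex cone `C` in a finite-dimensional real normed vector space,
the strict convex dual `C⊛` is nonempty if and only if the closure of `C` is salient,
i.e. `closure C ∩ (-closure C) ⊆ {0}`. -/
theorem stmt_2 {V : Type*} [NormedAddCommGroup V] [NormedSpace ℝ V]
    [FiniteDimensional ℝ V] (C : Set V) (hne : C.Nonempty)
    (hadd : ∀ v ∈ C, ∀ w ∈ C, v + w ∈ C)
    (hsmul : ∀ t : ℝ, 0 < t → ∀ v ∈ C, t • v ∈ C) :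
    (strictConeDual C).Nonempty ↔ closure C ∩ (-closure C) ⊆ {0} := by
  constructor
  · rintro ⟨u, hu⟩ v ⟨hv, hv'⟩
    by_contra hv0
    have h₁ := hu v hv hv0
    have h₂ := hu (-v) hv' (neg_ne_zero.mpr hv0)
    rw [map_neg] at h₂
    linarith
  · intro hsal
    exact exists_pos_of_salient isClosed_closure
      (fun v hv w hw ↦ map_mem_closure₂ continuous_add hv hw hadd)
      (fun t ht v hv ↦ map_mem_closure (continuous_const_smul t) hv (hsmul t ht)) hsal
end

section
/- Let C be a proper cone in a finite-dimensional real normed vector space V, i.e., a nonempty open convex cone with closure(C) ∩ (−closure(C)) ⊆ {0}. Then the strict convex dual C⊛ is a proper cone in V*, and the double strict convex dual recovers C: {v ∈ V : u(v) > 0 for every u ∈ closure(C⊛) with u ≠ 0} = C (i.e., C⊛⊛ = C under the canonical identification of V with its double dual). -/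
open Pointwise

open Filter Topology

section StrictConeDual

variable {V : Type*} [NormedAddCommGroup V] [NormedSpace ℝ V]

/-- A functional bounded below on a convex cone is nonnegative on it. -/
theorem ConvexCone.nonneg_of_forall_lt (K : ConvexCone ℝ V) {f : V →L[ℝ] ℝ} {c : ℝ}
    (hf : ∀ x ∈ K, c < f x) {x : V} (hx : x ∈ K) : 0 ≤ f x := by
  by_contra! hneg
  have ht : 0 < (|c| + 1) / (-f x) := div_pos (by positivity) (by linarith)
  have h := hf _ (K.smul_mem ht hx)
  rw [map_smul, smul_eq_mul, div_mul_eq_mul_div, div_neg, mul_div_cancel_right₀ _ hneg.ne] at h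
  linarith [neg_abs_le c]

/-- A strict lower bound of a functional on a nonempty convex cone is nonpositive. -/
theorem ConvexCone.nonpos_of_forall_lt (K : ConvexCone ℝ V) (hK : (K : Set V).Nonempty)
    {f : V →L[ℝ] ℝ} {c : ℝ} (hf : ∀ x ∈ K, c < f x) : c ≤ 0 := by
  obtain ⟨x, hx⟩ := hK
  have hlim : Tendsto (fun t : ℝ => t * f x) (𝓝[>] 0) (𝓝 0) := by
    have : Tendsto (fun t : ℝ => t * f x) (𝓝 0) (𝓝 (0 * f x)) :=
      (continuous_id.mul continuous_const).tendsto 0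
    rw [zero_mul] at this
    exact this.mono_left nhdsWithin_le_nhds
  refine ge_of_tendsto hlim (eventually_mem_nhdsWithin.mono fun t ht => ?_)
  simpa using (hf _ (K.smul_mem ht hx)).le

theorem ConvexCone.zero_mem_closure (K : ConvexCone ℝ V) (hK : (K : Set V).Nonempty) :
    (0 : V) ∈ _root_.closure (K : Set V) := by
  obtain ⟨x, hx⟩ := hK
  have hlim : Tendsto (fun t : ℝ => t • x) (𝓝[>] 0) (𝓝 0) := by
    have : Tendsto (fun t : ℝ => t • x) (𝓝 0) (𝓝 ((0 : ℝ) • x)) :=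
      (continuous_id.smul continuous_const).tendsto 0
    rw [zero_smul] at this
    exact this.mono_left nhdsWithin_le_nhds
  exact mem_closure_of_tendsto hlim
    (eventually_mem_nhdsWithin.mono fun t ht => K.smul_mem ht hx)

/-- A nonzero functional which is nonnegative on an open set is positive on it. -/
theorem ContinuousLinearMap.pos_of_nonneg_on_isOpen {C : Set V} (hC : IsOpen C) {f : V →L[ℝ] ℝ}
    (hf₀ : f ≠ 0) (hf : ∀ x ∈ C, 0 ≤ f x) {x : V} (hx : x ∈ C) : 0 < f x := by
  have hsub : f '' C ⊆ interior (Set.Ici 0) :=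
    interior_maximal (Set.image_subset_iff.2 hf) (f.isOpenMap_of_ne_zero hf₀ _ hC)
  rw [interior_Ici] at hsub
  exact hsub ⟨x, hx, rfl⟩

theorem nonneg_of_mem_closure_strictConeDual {C : Set V} {u : V →L[ℝ] ℝ}
    (hu : u ∈ closure (strictConeDual C)) {v : V} (hv : v ∈ closure C) : 0 ≤ u v := by
  have hclosed : IsClosed {w : V →L[ℝ] ℝ | 0 ≤ w v} :=
    isClosed_le continuous_const (ContinuousLinearMap.apply ℝ ℝ v).continuous
  refine closure_minimal (fun w hw => ?_) hclosed hu
  rcases eq_or_ne v 0 with rfl | hv₀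
  · simp
  · exact (hw v hv hv₀).le

theorem add_mem_strictConeDual_of_nonneg {C : Set V} {u w : V →L[ℝ] ℝ}
    (hu : ∀ v ∈ closure C, 0 ≤ u v) (hw : w ∈ strictConeDual C) : u + w ∈ strictConeDual C :=
  fun v hv hv₀ => add_pos_of_nonneg_of_pos (hu v hv) (hw v hv hv₀)

theorem smul_mem_strictConeDual {C : Set V} {u : V →L[ℝ] ℝ} {t : ℝ} (ht : 0 < t)
    (hu : u ∈ strictConeDual C) : t • u ∈ strictConeDual C :=
  fun v hv hv₀ => mul_pos ht (hu v hv hv₀)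

theorem add_mem_strictConeDual {C : Set V} {u w : V →L[ℝ] ℝ}
    (hu : u ∈ strictConeDual C) (hw : w ∈ strictConeDual C) : u + w ∈ strictConeDual C :=
  add_mem_strictConeDual_of_nonneg
    (fun _ hv => nonneg_of_mem_closure_strictConeDual (subset_closure hu) hv) hw

/-- When the strict dual is nonempty, its closure contains every functional which is nonnegative
on the cone. -/
theorem mem_closure_strictConeDual_of_nonneg {C : Set V} (hC : (strictConeDual C).Nonempty)
    {u : V →L[ℝ] ℝ} (hu : ∀ v ∈ C, 0 ≤ u v) : u ∈ closure (strictConeDual C) := by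
  obtain ⟨w, hw⟩ := hC
  have hu' : ∀ v ∈ closure C, 0 ≤ u v := fun v hv =>
    closure_minimal hu (isClosed_le continuous_const u.continuous) hv
  have hlim : Tendsto (fun t : ℝ => u + t • w) (𝓝[>] 0) (𝓝 u) := by
    have : Tendsto (fun t : ℝ => u + t • w) (𝓝 0) (𝓝 (u + (0 : ℝ) • w)) :=
      (continuous_const.add (continuous_id.smul continuous_const)).tendsto 0
    rw [zero_smul, add_zero] at this
    exact this.mono_left nhdsWithin_le_nhds
  exact mem_closure_of_tendsto hlim (eventually_mem_nhdsWithin.mono fun t ht =>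
    add_mem_strictConeDual_of_nonneg hu' (smul_mem_strictConeDual ht hw))

/-- For a cone, the strict dual is determined by the unit vectors of the closed cone. -/
theorem mem_strictConeDual_iff_forall_sphere (K : ConvexCone ℝ V) {u : V →L[ℝ] ℝ} :
    u ∈ strictConeDual (K : Set V) ↔
      ∀ v ∈ closure (K : Set V) ∩ Metric.sphere 0 1, 0 < u v := by
  refine ⟨fun hu v hv => hu v hv.1 (ne_zero_of_mem_unit_sphere ⟨v, hv.2⟩), fun hu v hv hv₀ => ?_⟩
  have hnorm : 0 < ‖v‖⁻¹ := inv_pos.2 (norm_pos_iff.2 hv₀)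
  have h := hu (‖v‖⁻¹ • v) ⟨K.closure.smul_mem hnorm hv, by simp [norm_smul, hv₀]⟩
  rw [map_smul, smul_eq_mul] at h
  exact pos_of_mul_pos_right h hnorm.le

/-- A vector whose negative is outside the closed cone is detected by a functional nonnegative
on the cone. -/
theorem ConvexCone.exists_nonneg_pos_of_neg_notMem_closure (K : ConvexCone ℝ V)
    (hK : (K : Set V).Nonempty) {v : V} (hv : -v ∉ _root_.closure (K : Set V)) :
    ∃ f : V →L[ℝ] ℝ, (∀ x ∈ _root_.closure (K : Set V), 0 ≤ f x) ∧ 0 < f v := by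
  obtain ⟨f, c, hfc, hf⟩ := geometric_hahn_banach_point_closed K.closure.convex
    isClosed_closure hv
  refine ⟨f, fun x hx => K.closure.nonneg_of_forall_lt hf hx, ?_⟩
  have h₀ := hf 0 (K.zero_mem_closure hK)
  rw [map_neg] at hfc
  rw [map_zero] at h₀
  linarith

variable [FiniteDimensional ℝ V]

theorem isCompact_closure_inter_unit_sphere (C : Set V) :
    IsCompact (closure C ∩ Metric.sphere 0 1) :=
  have : ProperSpace V := FiniteDimensional.proper ℝ V
  (isCompact_sphere 0 1).inter_left isClosed_closure

theorem isOpen_strictConeDual (K : ConvexCone ℝ V) : IsOpen (strictConeDual (K : Set V)) := by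
  refine isOpen_iff_eventually.2 fun u hu => ?_
  simp only [mem_strictConeDual_iff_forall_sphere] at hu ⊢
  refine (isCompact_closure_inter_unit_sphere (K : Set V)).eventually_forall_of_forall_eventually
    fun v hv => ?_
  have hcont : Continuous fun z : (V →L[ℝ] ℝ) × V => z.1 z.2 :=
    isBoundedBilinearMap_apply.continuous
  exact (isOpen_lt continuous_const hcont).mem_nhds (hu v hv)

theorem strictConeDual_nonempty (K : ConvexCone ℝ V) (hK : (K : Set V).Nonempty)
    (hsalient : closure (K : Set V) ∩ (-closure (K : Set V)) ⊆ {0}) :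
    (strictConeDual (K : Set V)).Nonempty := by
  have hexists : ∃ f : V →L[ℝ] ℝ, (∀ x ∈ closure (K : Set V), 0 ≤ f x) ∧
      ∀ x ∈ closure (K : Set V) ∩ Metric.sphere 0 1, 0 < f x := by
    refine (isCompact_closure_inter_unit_sphere (K : Set V)).induction_on
      (p := fun s => ∃ f : V →L[ℝ] ℝ, (∀ x ∈ closure (K : Set V), 0 ≤ f x) ∧ ∀ x ∈ s ∩
        closure (K : Set V), 0 < f x) ⟨0, by simp⟩ ?_ ?_ ?_ |>.imp fun f hf =>
          ⟨hf.1, fun x hx => hf.2 x ⟨hx, hx.1⟩⟩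
    · rintro s t hst ⟨f, hf, hft⟩
      exact ⟨f, hf, fun x hx => hft x ⟨hst hx.1, hx.2⟩⟩
    · rintro s t ⟨f, hf, hfs⟩ ⟨g, hg, hgt⟩
      refine ⟨f + g, fun x hx => add_nonneg (hf x hx) (hg x hx), ?_⟩
      rintro x ⟨hx | hx, hxK⟩
      · exact add_pos_of_pos_of_nonneg (hfs x ⟨hx, hxK⟩) (hg x hxK)
      · exact add_pos_of_nonneg_of_pos (hf x hxK) (hgt x ⟨hx, hxK⟩)
    · intro v hv
      have hneg : -v ∉ closure (K : Set V) := fun h =>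
        ne_zero_of_mem_unit_sphere ⟨v, hv.2⟩ (hsalient ⟨hv.1, h⟩)
      obtain ⟨f, hf, hfv⟩ := K.exists_nonneg_pos_of_neg_notMem_closure hK hneg
      exact ⟨{x | 0 < f x}, mem_nhdsWithin_of_mem_nhds
        ((isOpen_lt continuous_const f.continuous).mem_nhds hfv), f, hf, fun x hx => hx.1⟩
  obtain ⟨f, -, hf⟩ := hexists
  exact ⟨f, (mem_strictConeDual_iff_forall_sphere K).2 hf⟩

end StrictConeDual

/-- For a proper cone `C` (a nonempty open convex cone with salient closure) in a
finite-dimensional real normed vector space `V`, the strict convex dual `C⊛` is again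
a proper cone in the dual space, and the double strict convex dual recovers `C`:
`{v : V | u v > 0 for all nonzero u ∈ closure C⊛} = C`. -/
theorem stmt_3 {V : Type*} [NormedAddCommGroup V] [NormedSpace ℝ V]
    [FiniteDimensional ℝ V] (C : Set V) (hne : C.Nonempty) (hopen : IsOpen C)
    (hadd : ∀ v ∈ C, ∀ w ∈ C, v + w ∈ C)
    (hsmul : ∀ t : ℝ, 0 < t → ∀ v ∈ C, t • v ∈ C)
    (hsalient : closure C ∩ (-closure C) ⊆ {0}) :
    (strictConeDual C).Nonempty ∧ IsOpen (strictConeDual C) ∧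
      Convex ℝ (strictConeDual C) ∧
      (∀ u ∈ strictConeDual C, ∀ w ∈ strictConeDual C, u + w ∈ strictConeDual C) ∧
      (∀ t : ℝ, 0 < t → ∀ u ∈ strictConeDual C, t • u ∈ strictConeDual C) ∧
      closure (strictConeDual C) ∩ (-closure (strictConeDual C)) ⊆ {0} ∧
      {v : V | ∀ u ∈ closure (strictConeDual C), u ≠ 0 → 0 < u v} = C := by
  obtain ⟨K, rfl⟩ : ∃ K : ConvexCone ℝ V, (K : Set V) = C :=
    ⟨⟨C, fun t ht v hv => hsmul t ht v hv, fun v hv w hw => hadd v hv w hw⟩, rfl⟩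
  have hdual := strictConeDual_nonempty K hne hsalient
  have hpos : ∀ u ∈ closure (strictConeDual (K : Set V)), u ≠ 0 → ∀ v ∈ K, 0 < u v :=
    fun u hu hu₀ v hv => u.pos_of_nonneg_on_isOpen hopen hu₀
      (fun x hx => nonneg_of_mem_closure_strictConeDual hu (subset_closure hx)) hv
  refine ⟨hdual, isOpen_strictConeDual K,
    ConvexCone.convex ⟨_, fun _ ht _ hu => smul_mem_strictConeDual ht hu,
      fun _ hu _ hw => add_mem_strictConeDual hu hw⟩,
    fun _ hu _ hw => add_mem_strictConeDual hu hw,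
    fun _ ht _ hu => smul_mem_strictConeDual ht hu, ?_, ?_⟩
  · rintro u ⟨hu, hneg⟩
    by_contra hu₀
    obtain ⟨x, hx⟩ := hne
    have h₁ := hpos u hu hu₀ x hx
    have h₂ := nonneg_of_mem_closure_strictConeDual hneg (subset_closure hx)
    rw [neg_apply] at h₂
    linarith
  · refine Set.Subset.antisymm (fun v hv => ?_) fun v hv u hu hu₀ => hpos u hu hu₀ v hv
    by_contra hvK
    obtain ⟨f, hf⟩ := geometric_hahn_banach_point_open K.convex hopen hvK
    have hf₀ : f ≠ 0 := by
      rintro rfl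
      obtain ⟨x, hx⟩ := hne
      simpa using hf x hx
    have hmem := mem_closure_strictConeDual_of_nonneg hdual
      fun x hx => K.nonneg_of_forall_lt hf hx
    exact (hv f hmem hf₀).not_ge (K.nonpos_of_forall_lt hne hf)
end

section
/- Let C₁ and C₂ be proper cones in a finite-dimensional real normed vector space V (nonempty open convex cones whose closures are salient) with C₁ ∩ C₂ ≠ ∅. Then the strict convex dual of the intersection is the Minkowski sum of the strict convex duals: (C₁ ∩ C₂)⊛ = C₁⊛ + C₂⊛. -/
open Pointwise

open Set Filter Topology

/-- In a finite-dimensional space, the convex hull of a compact set is compact. -/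
theorem IsCompact.convexHull_of_finiteDimensional {E : Type*} [NormedAddCommGroup E]
    [NormedSpace ℝ E] [FiniteDimensional ℝ E] {D : Set E} (hD : IsCompact D) :
    IsCompact (convexHull ℝ D) := by
  have h : convexHull ℝ D = ⋃ k ∈ Finset.range (Module.finrank ℝ E + 2),
      (fun p : (Fin k → ℝ) × (Fin k → E) => ∑ i, p.1 i • p.2 i) ''
        (stdSimplex ℝ (Fin k) ×ˢ univ.pi fun _ => D) := by
    apply Subset.antisymm
    · intro x hx
      obtain ⟨ι, _, z, w, hz, hind, hw, hw1, rfl⟩ := eq_pos_convex_span_of_mem_convexHull hx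
      have hcard : Fintype.card ι < Module.finrank ℝ E + 2 := by
        have h₁ := hind.card_le_finrank_succ
        have h₂ := Submodule.finrank_le (vectorSpan ℝ (range z))
        omega
      let e := Fintype.equivFin ι
      refine mem_biUnion (Finset.mem_coe.2 (Finset.mem_range.2 hcard))
        ⟨(w ∘ e.symm, z ∘ e.symm), ⟨⟨fun i => (hw _).le, ?_⟩, fun i _ => hz ⟨_, rfl⟩⟩, ?_⟩
      · exact (e.symm.sum_comp w).trans hw1
      · exact e.symm.sum_comp fun i => w i • z i
    · refine iUnion₂_subset fun k _ => ?_
      rintro _ ⟨⟨w, z⟩, ⟨hw, hz⟩, rfl⟩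
      exact (convex_convexHull ℝ D).sum_mem (fun i _ => hw.1 i) hw.2
        fun i _ => subset_convexHull ℝ D (hz i trivial)
  rw [h]
  refine Finset.isCompact_biUnion _ fun k _ => ?_
  exact ((isCompact_stdSimplex ℝ (Fin k)).prod (isCompact_univ_pi fun _ => hD)).image (by fun_prop)

/-- A compact set whose convex hull avoids the origin lies in an open half-space. -/
theorem exists_forall_pos_of_zero_notMem_convexHull {E : Type*} [NormedAddCommGroup E]
    [NormedSpace ℝ E] [FiniteDimensional ℝ E] {D : Set E} (hD : IsCompact D)
    (h0 : (0 : E) ∉ convexHull ℝ D) : ∃ f : E →L[ℝ] ℝ, ∀ x ∈ D, 0 < f x := by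
  obtain ⟨f, a, ha, hf⟩ := geometric_hahn_banach_point_closed (convex_convexHull ℝ D)
    hD.convexHull_of_finiteDimensional.isClosed h0
  refine ⟨f, fun x hx => ?_⟩
  have := hf x (subset_convexHull ℝ D hx)
  rw [map_zero] at ha
  exact ha.trans this

/-- A functional that is positive on the unit vectors of a cone is positive on all its nonzero
vectors. -/
theorem ProperCone.pos_of_pos_on_sphere {V : Type*} [NormedAddCommGroup V] [NormedSpace ℝ V]
    {K : ProperCone ℝ V} {f : V →L[ℝ] ℝ}
    (hf : ∀ v ∈ K, v ∈ Metric.sphere (0 : V) 1 → 0 < f v) {v : V} (hv : v ∈ K) (hv0 : v ≠ 0) :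
    0 < f v := by
  have hn : 0 < ‖v‖⁻¹ := inv_pos.2 (norm_pos_iff.2 hv0)
  have h := hf (‖v‖⁻¹ • v) (K.smul_mem hv hn.le)
    (by simp [norm_smul, inv_mul_cancel₀ (norm_ne_zero_iff.2 hv0)])
  rw [map_smul, smul_eq_mul] at h
  exact pos_of_mul_pos_right h hn.le

/-- In a salient cone, a sum of two vectors vanishes only if both do. -/
theorem ProperCone.eq_zero_of_add_eq_zero {V : Type*} [NormedAddCommGroup V] [NormedSpace ℝ V]
    {K : ProperCone ℝ V} (hK : ∀ v ∈ K, -v ∈ K → v = 0) {v w : V} (hv : v ∈ K) (hw : w ∈ K)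
    (h : v + w = 0) : v = 0 :=
  hK v hv (by rwa [neg_eq_of_add_eq_zero_right h])

/-- A functional positive on the nonzero vectors of the intersection of two closed salient cones
is a sum of functionals positive on the nonzero vectors of the respective cones. -/
theorem ProperCone.exists_add_eq_of_pos_on_inter {V : Type*} [NormedAddCommGroup V]
    [NormedSpace ℝ V] [FiniteDimensional ℝ V] {K₁ K₂ : ProperCone ℝ V}
    (h₁ : ∀ v ∈ K₁, -v ∈ K₁ → v = 0) (h₂ : ∀ v ∈ K₂, -v ∈ K₂ → v = 0) {u : V →L[ℝ] ℝ}
    (hu : ∀ v ∈ K₁, v ∈ K₂ → v ≠ 0 → 0 < u v) :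
    ∃ u₁ u₂ : V →L[ℝ] ℝ, (∀ v ∈ K₁, v ≠ 0 → 0 < u₁ v) ∧ (∀ v ∈ K₂, v ≠ 0 → 0 < u₂ v) ∧
      u₁ + u₂ = u := by
  let Q : Set (V × ℝ) := {p | ∃ v ∈ K₁, ∃ w ∈ K₂, ∃ s : ℝ, 0 ≤ s ∧ (v = 0 → w = 0 → s ≠ 0) ∧
    p = (v - w, u w + s)}
  have hQ : Convex ℝ Q := by
    refine convex_iff_forall_pos.2 ?_
    rintro _ ⟨v, hv, w, hw, s, hs, hne, rfl⟩ _ ⟨v', hv', w', hw', s', hs', -, rfl⟩ a b ha hb -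
    have hav := K₁.smul_mem hv ha.le
    have hbv := K₁.smul_mem hv' hb.le
    have haw := K₂.smul_mem hw ha.le
    have hbw := K₂.smul_mem hw' hb.le
    refine ⟨a • v + b • v', add_mem hav hbv, a • w + b • w', add_mem haw hbw,
      a * s + b * s', by positivity, fun hv0 hw0 hs0 => ?_, ?_⟩
    · refine hne ((smul_eq_zero.1 (eq_zero_of_add_eq_zero h₁ hav hbv hv0)).resolve_left ha.ne')
        ((smul_eq_zero.1 (eq_zero_of_add_eq_zero h₂ haw hbw hw0)).resolve_left ha.ne') ?_
      have := mul_nonneg ha.le hs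
      have := mul_nonneg hb.le hs'
      exact (mul_eq_zero.1 (by linarith : a * s = 0)).resolve_left ha.ne'
    · ext
      · simp only [Prod.fst_add, Prod.smul_fst]
        module
      · simp only [Prod.snd_add, Prod.smul_snd, map_add, map_smul, smul_eq_mul]
        ring
  have hQ0 : (0 : V × ℝ) ∉ Q := by
    rintro ⟨v, hv, w, hw, s, hs, hne, h⟩
    obtain ⟨hvw, hsum⟩ := Prod.mk.inj h
    obtain rfl : v = w := sub_eq_zero.1 hvw.symm
    by_cases hv0 : v = 0
    · subst hv0
      rw [map_zero, zero_add] at hsum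
      exact hne rfl rfl hsum.symm
    · have := hu v hv hw hv0
      linarith
  let S : Set V := Metric.sphere 0 1
  have hS0 : ∀ v ∈ S, v ≠ 0 := fun v hv => ne_zero_of_mem_unit_sphere ⟨v, hv⟩
  have hS (K : ProperCone ℝ V) : IsCompact ((K : Set V) ∩ S) :=
    (isCompact_sphere 0 1).inter_left K.isClosed
  let D : Set (V × ℝ) := (fun v => (v, 0)) '' ((K₁ : Set V) ∩ S) ∪
    (fun w => (-w, u w)) '' ((K₂ : Set V) ∩ S) ∪ {(0, 1)}
  have hD : IsCompact D :=
    (((hS K₁).image (by fun_prop)).union ((hS K₂).image (by fun_prop))).union isCompact_singleton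
  have hDQ : D ⊆ Q := by
    rintro _ ((⟨v, ⟨hv, hvS⟩, rfl⟩ | ⟨w, ⟨hw, hwS⟩, rfl⟩) | rfl)
    · exact ⟨v, hv, 0, zero_mem _, 0, le_rfl, fun h => absurd h (hS0 v hvS), by simp⟩
    · exact ⟨0, zero_mem _, w, hw, 0, le_rfl, fun _ h => absurd h (hS0 w hwS), by simp⟩
    · exact ⟨0, zero_mem _, 0, zero_mem _, 1, zero_le_one, fun _ _ => one_ne_zero, by simp⟩
  obtain ⟨f, hf⟩ := exists_forall_pos_of_zero_notMem_convexHull hD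
    fun h => hQ0 (convexHull_min hDQ hQ h)
  have hc : 0 < f (0, 1) := hf _ (Or.inr rfl)
  let g : V →L[ℝ] ℝ := (f (0, 1))⁻¹ • f.comp (.inl ℝ V ℝ)
  refine ⟨g, u - g, fun v hv hv0 => ?_, fun v hv hv0 => ?_, add_sub_cancel _ _⟩
  · refine K₁.pos_of_pos_on_sphere (fun x hx hxS => ?_) hv hv0
    exact mul_pos (inv_pos.2 hc) (hf _ (Or.inl (Or.inl ⟨x, ⟨hx, hxS⟩, rfl⟩)))
  · refine K₂.pos_of_pos_on_sphere (fun x hx hxS => ?_) hv hv0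
    have h := hf _ (Or.inl (Or.inr ⟨x, ⟨hx, hxS⟩, rfl⟩))
    have hx : ((-x, u x) : V × ℝ) = u x • (0, 1) - (x, 0) := by simp
    have hg : (u - g) x = (f (0, 1))⁻¹ * f (-x, u x) := by
      rw [hx, map_sub, map_smul]
      simp only [g, sub_apply, smul_apply,
        ContinuousLinearMap.comp_apply, ContinuousLinearMap.inl_apply, smul_eq_mul]
      field_simp
    rw [hg]
    exact mul_pos (inv_pos.2 hc) h

/-- The closure of a nonempty set stable under addition and positive scaling, as a closed cone. -/
def properConeClosure {V : Type*} [NormedAddCommGroup V] [NormedSpace ℝ V] (C : Set V)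
    (hne : C.Nonempty) (hadd : ∀ v ∈ C, ∀ w ∈ C, v + w ∈ C)
    (hsmul : ∀ t : ℝ, 0 < t → ∀ v ∈ C, t • v ∈ C) : ProperCone ℝ V :=
  let K : ConvexCone ℝ V :=
    { carrier := C, smul_mem' := fun t ht v hv => hsmul t ht v hv,
      add_mem' := fun v hv w hw => hadd v hv w hw }
  { K.closure.toPointedCone
      (.of_nonempty_of_isClosed (hne.mono subset_closure) isClosed_closure) with
    isClosed' := isClosed_closure }

/-- A common point of the closures of two open cones that meet is in the closure of their
intersection. -/
theorem closure_inter_closure_subset_of_isOpen_cone {V : Type*} [NormedAddCommGroup V]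
    [NormedSpace ℝ V] {C₁ C₂ : Set V} (hopen₁ : IsOpen C₁) (hopen₂ : IsOpen C₂)
    (hadd₁ : ∀ v ∈ C₁, ∀ w ∈ C₁, v + w ∈ C₁) (hadd₂ : ∀ v ∈ C₂, ∀ w ∈ C₂, v + w ∈ C₂)
    (hsmul₁ : ∀ t : ℝ, 0 < t → ∀ v ∈ C₁, t • v ∈ C₁)
    (hsmul₂ : ∀ t : ℝ, 0 < t → ∀ v ∈ C₂, t • v ∈ C₂) (hint : (C₁ ∩ C₂).Nonempty) :
    closure C₁ ∩ closure C₂ ⊆ closure (C₁ ∩ C₂) := by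
  have key {C : Set V} (hC : IsOpen C) (hadd : ∀ v ∈ C, ∀ w ∈ C, v + w ∈ C) {v w : V}
      (hv : v ∈ closure C) (hw : w ∈ C) : v + w ∈ C := by
    have h : v + w ∈ closure C + C := Set.add_mem_add hv hw
    rw [hC.closure_add] at h
    obtain ⟨a, ha, b, hb, hab⟩ := h
    exact hab ▸ hadd a ha b hb
  rintro v ⟨hv₁, hv₂⟩
  obtain ⟨x, hx₁, hx₂⟩ := hint
  have hlim : Tendsto (fun t : ℝ => v + t • x) (𝓝[>] 0) (𝓝 v) := by
    have : Continuous fun t : ℝ => v + t • x := by fun_prop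
    simpa using (this.tendsto 0).mono_left nhdsWithin_le_nhds
  refine mem_closure_of_tendsto hlim ?_
  filter_upwards [self_mem_nhdsWithin] with t ht
  exact ⟨key hopen₁ hadd₁ hv₁ (hsmul₁ t ht x hx₁), key hopen₂ hadd₂ hv₂ (hsmul₂ t ht x hx₂)⟩

/-- For proper cones `C₁`, `C₂` (nonempty open convex cones with salient closures) in
a finite-dimensional real normed vector space with `C₁ ∩ C₂ ≠ ∅`, the strict convex
dual of the intersection is the Minkowski sum of the strict convex duals:
`(C₁ ∩ C₂)⊛ = C₁⊛ + C₂⊛`. -/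
theorem stmt_6 {V : Type*} [NormedAddCommGroup V] [NormedSpace ℝ V]
    [FiniteDimensional ℝ V] (C₁ C₂ : Set V)
    (hne₁ : C₁.Nonempty) (hne₂ : C₂.Nonempty)
    (hopen₁ : IsOpen C₁) (hopen₂ : IsOpen C₂)
    (hadd₁ : ∀ v ∈ C₁, ∀ w ∈ C₁, v + w ∈ C₁)
    (hadd₂ : ∀ v ∈ C₂, ∀ w ∈ C₂, v + w ∈ C₂)
    (hsmul₁ : ∀ t : ℝ, 0 < t → ∀ v ∈ C₁, t • v ∈ C₁)
    (hsmul₂ : ∀ t : ℝ, 0 < t → ∀ v ∈ C₂, t • v ∈ C₂)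
    (hsalient₁ : closure C₁ ∩ (-closure C₁) ⊆ {0})
    (hsalient₂ : closure C₂ ∩ (-closure C₂) ⊆ {0})
    (hint : (C₁ ∩ C₂).Nonempty) :
    strictConeDual (C₁ ∩ C₂) = strictConeDual C₁ + strictConeDual C₂ := by
  apply Subset.antisymm
  · intro u hu
    obtain ⟨u₁, u₂, hu₁, hu₂, h⟩ := ProperCone.exists_add_eq_of_pos_on_inter
      (K₁ := properConeClosure C₁ hne₁ hadd₁ hsmul₁)
      (K₂ := properConeClosure C₂ hne₂ hadd₂ hsmul₂) (u := u)
      (fun v hv hv' => hsalient₁ ⟨hv, hv'⟩) (fun v hv hv' => hsalient₂ ⟨hv, hv'⟩)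
      (fun v hv₁ hv₂ => hu v (closure_inter_closure_subset_of_isOpen_cone hopen₁ hopen₂ hadd₁
        hadd₂ hsmul₁ hsmul₂ hint ⟨hv₁, hv₂⟩))
    exact ⟨u₁, hu₁, u₂, hu₂, h⟩
  · rintro _ ⟨u₁, hu₁, u₂, hu₂, rfl⟩ v hv hv0
    exact add_pos (hu₁ v (closure_mono inter_subset_left hv) hv0)
      (hu₂ v (closure_mono inter_subset_right hv) hv0)
end

section
/- Assume: (i) the pairing ⟨·,·⟩ : V × W → ℝ is nondegenerate in its second argument (if ⟨ψ, α⟩ = 0 for all ψ ∈ V then α = 0); (ii) ⟪·,·⟫ : P' × Q' → ℝ is nondegenerate in its first argument (if ⟪x, β⟫ = 0 for all β ∈ Q' then x = 0); (iii) ker g' ⊆ range g (global recognizability of gauge transformations); (iv) ĝ ∘ G = 0. Then the pairing ⟨·,·⟩ descends to a nondegenerate pairing between V / range(g) and ker ĝ, namely: (a) ⟨g ε, α⟩ = 0 for every ε ∈ P and every α ∈ ker ĝ; (b) if ψ ∈ V satisfies ⟨ψ, α⟩ = 0 for all α ∈ ker ĝ, then ψ ∈ range g; (c) if α ∈ ker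 ĝ satisfies ⟨ψ, α⟩ = 0 for all ψ ∈ V, then α = 0. -/
/-- Nondegeneracy of the natural pairing between the gauge-invariant formal tangent
space `V / range g` and the gauge-invariant formal cotangent space `ker ĝ`: under
nondegeneracy of the native pairings, global recognizability of gauge transformations
(`ker g' ⊆ range g`), and `ĝ ∘ G = 0`, (a) pure gauge directions pair to zero with
gauge-invariant dual densities, (b) anything pairing to zero with all gauge-invariant
dual densities is pure gauge, and (c) any gauge-invariant dual density pairing to zero
with everything vanishes. -/
theorem stmt_9 {V W P Q P' Q' : Type*}
    [AddCommGroup V] [Module ℝ V] [AddCommGroup W] [Module ℝ W]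
    [AddCommGroup P] [Module ℝ P] [AddCommGroup Q] [Module ℝ Q]
    [AddCommGroup P'] [Module ℝ P'] [AddCommGroup Q'] [Module ℝ Q']
    (pair : V →ₗ[ℝ] W →ₗ[ℝ] ℝ) (pair1 : P →ₗ[ℝ] Q →ₗ[ℝ] ℝ)
    (pair2 : P' →ₗ[ℝ] Q' →ₗ[ℝ] ℝ)
    (g : P →ₗ[ℝ] V) (ghat : W →ₗ[ℝ] Q) (g' : V →ₗ[ℝ] P') (G : Q' →ₗ[ℝ] W)
    (hadj_g : ∀ (ε : P) (α : W), pair (g ε) α = pair1 ε (ghat α))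
    (hadj_G : ∀ (ψ : V) (β : Q'), pair ψ (G β) = pair2 (g' ψ) β)
    (hnd2 : ∀ α : W, (∀ ψ : V, pair ψ α = 0) → α = 0)
    (hnd1 : ∀ x : P', (∀ β : Q', pair2 x β = 0) → x = 0)
    (hrec : ∀ ψ : V, g' ψ = 0 → ψ ∈ LinearMap.range g)
    (hgG : ∀ β : Q', ghat (G β) = 0) :
    (∀ (ε : P) (α : W), ghat α = 0 → pair (g ε) α = 0) ∧
      (∀ ψ : V, (∀ α : W, ghat α = 0 → pair ψ α = 0) → ψ ∈ LinearMap.range g) ∧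
      (∀ α : W, ghat α = 0 → (∀ ψ : V, pair ψ α = 0) → α = 0) := by
  refine ⟨fun ε α hα => ?_, fun ψ hψ => ?_, fun α _ hα => hnd2 α hα⟩
  · rw [hadj_g, hα, map_zero]
  · refine hrec ψ (hnd1 _ fun β => ?_)
    rw [← hadj_G]
    exact hψ _ (hgG β)
end

section
/- Assume: (i) E(J ξ) ∈ range(g) for every ξ ∈ V; (ii) the anti-self-adjointness identity E = −E' − g ∘ a ∘ E − E' ∘ p ∘ ĝ holds as an identity of linear maps W → V; (iii) ĝ ∘ c = 0; (iv) E' ∘ c = g ∘ t. Then E(J ξ + c γ) ∈ range(g) for every ξ ∈ V and γ ∈ U; equivalently, the Peierls map α ↦ E α sends the subspace range(J) + range(c) of W into range(g), so that it descends to a well-defined map on equivalence classes modulo range(J) + range(c) with values in V / range(g). -/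
/-- The Peierls map descends to gauge equivalence classes: under the hypotheses
(i) `E (J ξ) ∈ range g`, (ii) the anti-self-adjointness identity
`E = -E' - g ∘ a ∘ E - E' ∘ p ∘ ĝ`, (iii) `ĝ ∘ c = 0`, and (iv) `E' ∘ c = g ∘ t`,
the causal Green operator `E` maps `range J + range c` into `range g`; equivalently,
`E (J ξ + c γ) ∈ range g` for all `ξ`, `γ`, so `α ↦ E α` descends to a well-defined
map on classes modulo `range J + range c` valued in `V / range g`. -/
theorem stmt_12 {V W U P Q : Type*}
    [AddCommGroup V] [Module ℝ V] [AddCommGroup W] [Module ℝ W]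
    [AddCommGroup U] [Module ℝ U] [AddCommGroup P] [Module ℝ P]
    [AddCommGroup Q] [Module ℝ Q]
    (E E' : W →ₗ[ℝ] V) (J : V →ₗ[ℝ] W) (g : P →ₗ[ℝ] V) (a : V →ₗ[ℝ] P)
    (p : Q →ₗ[ℝ] W) (ghat : W →ₗ[ℝ] Q) (c : U →ₗ[ℝ] W) (t : U →ₗ[ℝ] P)
    (h1 : ∀ ξ : V, E (J ξ) ∈ LinearMap.range g)
    (h2 : ∀ α : W, E α = -(E' α) - g (a (E α)) - E' (p (ghat α)))
    (h3 : ∀ γ : U, ghat (c γ) = 0)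
    (h4 : ∀ γ : U, E' (c γ) = g (t γ)) :
    (∀ (ξ : V) (γ : U), E (J ξ + c γ) ∈ LinearMap.range g) ∧
      ∀ α ∈ (LinearMap.range J ⊔ LinearMap.range c : Submodule ℝ W),
        E α ∈ LinearMap.range g := by
  have hc (γ : U) : E (c γ) ∈ LinearMap.range g :=
    ⟨-t γ - a (E (c γ)), by
      conv_rhs => rw [h2]
      simp [h3, h4]⟩
  have hJc (ξ : V) (γ : U) : E (J ξ + c γ) ∈ LinearMap.range g := by
    rw [map_add]
    exact add_mem (h1 ξ) (hc γ)
  refine ⟨hJc, fun α hα => ?_⟩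
  obtain ⟨_, ⟨ξ, rfl⟩, _, ⟨γ, rfl⟩, rfl⟩ := Submodule.mem_sup.mp hα
  exact hJc ξ γ
end
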